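/- arXiv:2310.02114 — 9 statements merged into one kernel-verified Lean document; each statement's English description precedes it below -/
import Mathlib

section
/- Let 𝔤 be a finite-dimensional simple real Lie algebra with Killing form κ, and let L : 𝔤 → 𝔤 be an ℝ-linear map in K(𝔤), i.e. L([x,y]) = [L(x),y] for all x,y ∈ 𝔤. Then L is symmetric with respect to κ: κ(L(x), y) = κ(x, L(y)) for all x, y ∈ 𝔤. -/
/-- A linear map `f` with `f ⁅x, y⁆ = ⁅f x, y⁆` satisfies `ad (f x) = f ∘ ad x`. -/
theorem LieAlgebra.ad_apply_eq_mul_ad {R M : Type*} [CommRing R] [LieRing M] [LieAlgebra R M]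
    {f : M →ₗ[R] M} (hf : ∀ x y : M, f ⁅x, y⁆ = ⁅f x, y⁆) (x : M) :
    LieAlgebra.ad R M (f x) = f * LieAlgebra.ad R M x := by
  ext z
  simp [hf]

/-- A linear map `f` with `f ⁅x, y⁆ = ⁅f x, y⁆` commutes with every `ad x`. -/
theorem LieAlgebra.commute_ad {R M : Type*} [CommRing R] [LieRing M] [LieAlgebra R M]
    {f : M →ₗ[R] M} (hf : ∀ x y : M, f ⁅x, y⁆ = ⁅f x, y⁆) (x : M) :
    Commute f (LieAlgebra.ad R M x) := by
  ext z
  simp only [Module.End.mul_apply, LieAlgebra.ad_apply]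
  rw [← lie_skew x z, ← lie_skew x (f z), map_neg, hf]


/-- On a finite-dimensional simple real Lie algebra, every linear map `L` satisfying
`L([x,y]) = [L(x),y]` is symmetric with respect to the Killing form. -/
theorem killingForm_symm_of_commutes_with_ad
    {𝔤 : Type*} [LieRing 𝔤] [LieAlgebra ℝ 𝔤] [Module.Finite ℝ 𝔤]
    [LieAlgebra.IsSimple ℝ 𝔤]
    (L : 𝔤 →ₗ[ℝ] 𝔤) (hL : ∀ x y : 𝔤, L ⁅x, y⁆ = ⁅L x, y⁆) :
    ∀ x y : 𝔤, killingForm ℝ 𝔤 (L x) y = killingForm ℝ 𝔤 x (L y) := by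
  intro x y
  simp only [killingForm_apply_apply, ← Module.End.mul_eq_comp]
  rw [LieAlgebra.ad_apply_eq_mul_ad hL, LieAlgebra.ad_apply_eq_mul_ad hL,
    (LieAlgebra.commute_ad hL x).eq, mul_assoc]
end

section
/- Let 𝔤 be a finite-dimensional simple real Lie algebra. Then K(𝔤) is a real vector subspace of End(𝔤) of dimension at most 2. -/
/-- `K(𝔤)`, the space of linear maps `L : 𝔤 → 𝔤` with `L([x,y]) = [L(x),y]`,
as a real subspace of `End(𝔤)`. -/
def Ksub (𝔤 : Type*) [LieRing 𝔤] [LieAlgebra ℝ 𝔤] : Submodule ℝ (𝔤 →ₗ[ℝ] 𝔤) where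
  carrier := {L | ∀ x y : 𝔤, L ⁅x, y⁆ = ⁅L x, y⁆}
  add_mem' := by
    intro L M hL hM x y
    simp [hL x y, hM x y, add_lie]
  zero_mem' := by intro x y; simp
  smul_mem' := by
    intro c L hL x y
    simp [hL x y, smul_lie]

namespace Ksub

variable {𝔤 : Type*} [LieRing 𝔤] [LieAlgebra ℝ 𝔤] {L M : 𝔤 →ₗ[ℝ] 𝔤}

theorem map_lie_right (hL : L ∈ Ksub 𝔤) (x y : 𝔤) : L ⁅x, y⁆ = ⁅x, L y⁆ := by
  rw [← lie_skew, map_neg, hL y x, lie_skew]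

theorem one_mem : 1 ∈ Ksub 𝔤 := fun _ _ ↦ rfl

theorem mul_mem (hL : L ∈ Ksub 𝔤) (hM : M ∈ Ksub 𝔤) : L * M ∈ Ksub 𝔤 := fun x y ↦ by
  rw [Module.End.mul_apply, hM x y, hL (M x) y, Module.End.mul_apply]

/-- The kernel of a map in `K(𝔤)`, as a Lie ideal. -/
def kerIdeal (hL : L ∈ Ksub 𝔤) : LieIdeal ℝ 𝔤 where
  toSubmodule := LinearMap.ker L
  lie_mem {x m} (hm : L m = 0) := show L ⁅x, m⁆ = 0 by rw [map_lie_right hL, hm, lie_zero]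

section IsSimple

variable [LieAlgebra.IsSimple ℝ 𝔤]

theorem injective (hL : L ∈ Ksub 𝔤) (h : L ≠ 0) : Function.Injective L := by
  refine LinearMap.ker_eq_bot.mp ?_
  rcases LieAlgebra.IsSimple.eq_bot_or_eq_top (R := ℝ) (kerIdeal hL) with h' | h'
  · exact congrArg LieSubmodule.toSubmodule h'
  · exact absurd (LinearMap.ker_eq_top.mp (congrArg LieSubmodule.toSubmodule h')) h

theorem mul_comm (hL : L ∈ Ksub 𝔤) (hM : M ∈ Ksub 𝔤) : L * M = M * L := by
  by_contra h
  have inj := injective (sub_mem (mul_mem hL hM) (mul_mem hM hL)) (sub_ne_zero.mpr h)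
  refine LieAlgebra.IsSimple.non_abelian ℝ (L := 𝔤) ⟨fun x y ↦ inj ?_⟩
  rw [map_zero, LinearMap.sub_apply, Module.End.mul_apply, Module.End.mul_apply,
    hM x y, map_lie_right hL, map_lie_right hL, hM, sub_self]

end IsSimple

variable (𝔤) in
/-- `K(𝔤)` as a subalgebra of `End(𝔤)`. -/
def subalgebra : Subalgebra ℝ (Module.End ℝ 𝔤) :=
  (Ksub 𝔤).toSubalgebra one_mem fun _ _ ↦ mul_mem

variable [LieAlgebra.IsSimple ℝ 𝔤]

instance : CommRing (subalgebra 𝔤) where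
  mul_comm a b := Subtype.ext (mul_comm a.2 b.2)

instance : IsDomain (subalgebra 𝔤) :=
  have : Nontrivial 𝔤 := LieAlgebra.IsSimple.nontrivial ℝ 𝔤
  have : NoZeroDivisors (subalgebra 𝔤) := ⟨fun {a _} h ↦ or_iff_not_imp_left.mpr fun ha ↦
    Subtype.ext <| LinearMap.ext fun x ↦
      injective a.2 (fun h' ↦ ha (Subtype.ext h')) <|
        (LinearMap.congr_fun (congrArg Subtype.val h) x).trans (map_zero a.1).symm⟩
  NoZeroDivisors.to_isDomain _

end Ksub

/-- On a finite-dimensional simple real Lie algebra, `K(𝔤)` has dimension at most `2`. -/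
theorem finrank_K_le_two
    (𝔤 : Type*) [LieRing 𝔤] [LieAlgebra ℝ 𝔤] [Module.Finite ℝ 𝔤]
    [LieAlgebra.IsSimple ℝ 𝔤] :
    Module.finrank ℝ (Ksub 𝔤) ≤ 2 := by
  let : Field (Ksub.subalgebra 𝔤) := fieldOfFiniteDimensional ℝ _
  change Module.finrank ℝ (Ksub.subalgebra 𝔤) ≤ 2
  rcases Real.nonempty_algEquiv_or (Ksub.subalgebra 𝔤) with ⟨⟨e⟩⟩ | ⟨⟨e⟩⟩
  · simp [e.toLinearEquiv.finrank_eq]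
  · exact (e.toLinearEquiv.finrank_eq.trans Complex.finrank_real_complex).le
end

section
/- Let 𝔤 be a finite-dimensional simple real Lie algebra of odd dimension. Then every L ∈ K(𝔤) is a real scalar multiple of the identity map of 𝔤. -/
open Filter in
theorem Polynomial.Monic.exists_isRoot_of_odd_natDegree {p : Polynomial ℝ} (hp : p.Monic)
    (hodd : Odd p.natDegree) : ∃ x, p.IsRoot x := by
  have hdeg : 0 < p.degree := Polynomial.natDegree_pos_iff_degree_pos.mp hodd.pos
  have htop : Tendsto (fun x ↦ p.eval x) atTop atTop :=
    p.tendsto_atTop_of_leadingCoeff_nonneg hdeg (by simp [hp.leadingCoeff])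
  have hneg : Tendsto (fun x ↦ (p.comp (-Polynomial.X)).eval x) atTop atBot := by
    apply Polynomial.tendsto_atBot_of_leadingCoeff_nonpos
    · rw [← Polynomial.natDegree_pos_iff_degree_pos, Polynomial.natDegree_comp]
      simpa using hodd.pos
    · rw [Polynomial.leadingCoeff_comp (by simp)]
      simp [hp.leadingCoeff, hodd.neg_one_pow]
  have hbot : Tendsto (fun x ↦ p.eval x) atBot atBot := by
    simpa [Function.comp_def] using hneg.comp tendsto_neg_atBot_atTop
  exact p.continuous.surjective htop hbot 0

theorem Module.End.exists_hasEigenvalue_of_odd_finrank {V : Type*} [AddCommGroup V] [Module ℝ V]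
    [Module.Finite ℝ V] (hodd : Odd (Module.finrank ℝ V)) (f : Module.End ℝ V) :
    ∃ c : ℝ, f.HasEigenvalue c := by
  simp_rw [Module.End.hasEigenvalue_iff_isRoot_charpoly]
  exact f.charpoly_monic.exists_isRoot_of_odd_natDegree (by rwa [LinearMap.charpoly_natDegree])

/-- The eigenspaces of a map commuting with the adjoint action are ideals. -/
def LieIdeal.eigenspace {R 𝔤 : Type*} [CommRing R] [LieRing 𝔤] [LieAlgebra R 𝔤]
    (L : 𝔤 →ₗ[R] 𝔤) (hL : ∀ x y : 𝔤, L ⁅x, y⁆ = ⁅L x, y⁆) (c : R) : LieIdeal R 𝔤 where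
  __ := Module.End.eigenspace L c
  lie_mem {x v} hv := by
    have hv : L v = c • v := Module.End.mem_eigenspace_iff.mp hv
    refine Module.End.mem_eigenspace_iff.mpr ?_
    rw [← lie_skew, map_neg, hL, hv, smul_lie, smul_neg]

/-- On an odd-dimensional simple real Lie algebra, every linear map `L` with
`L([x,y]) = [L(x),y]` is a real scalar multiple of the identity. -/
theorem K_eq_scalar_of_odd_dim
    {𝔤 : Type*} [LieRing 𝔤] [LieAlgebra ℝ 𝔤] [Module.Finite ℝ 𝔤]
    [LieAlgebra.IsSimple ℝ 𝔤]
    (hodd : Odd (Module.finrank ℝ 𝔤))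
    (L : 𝔤 →ₗ[ℝ] 𝔤) (hL : ∀ x y : 𝔤, L ⁅x, y⁆ = ⁅L x, y⁆) :
    ∃ c : ℝ, L = c • (LinearMap.id : 𝔤 →ₗ[ℝ] 𝔤) := by
  obtain ⟨c, hc⟩ := Module.End.exists_hasEigenvalue_of_odd_finrank hodd L
  obtain ⟨v, hv⟩ := hc.exists_hasEigenvector
  have hmem : v ∈ LieIdeal.eigenspace L hL c := hv.1
  refine ⟨c, LinearMap.ext fun x ↦ ?_⟩
  rcases LieAlgebra.IsSimple.eq_bot_or_eq_top (R := ℝ) (LieIdeal.eigenspace L hL c) with h | h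
  · rw [h, LieSubmodule.mem_bot] at hmem
    exact absurd hmem hv.2
  · have hx : x ∈ LieIdeal.eigenspace L hL c := h ▸ LieSubmodule.mem_top x
    exact Module.End.mem_eigenspace_iff.mp hx
end

section
/- Let 𝔤 be a finite-dimensional real Lie algebra which is perfect ([𝔤,𝔤] = 𝔤) and admits a nondegenerate ad-invariant symmetric bilinear form. Then the cotangent Lie algebra T*𝔤 is perfect: [T*𝔤, T*𝔤] = T*𝔤. In particular this holds when 𝔤 is semisimple. -/
/-- Bracket of the cotangent Lie algebra `T*𝔤 = 𝔤 × 𝔤*`: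
`[(x,f),(y,g)] = ([x,y], ad*_x g − ad*_y f)`, where `(ad*_x g)(y) = −g([x,y])`. -/
def cotBracket {L : Type*} [LieRing L] [LieAlgebra ℝ L]
    (p q : L × Module.Dual ℝ L) : L × Module.Dual ℝ L :=
  (⁅p.1, q.1⁆,
    p.2 ∘ₗ (LieAlgebra.ad ℝ L q.1) - q.2 ∘ₗ (LieAlgebra.ad ℝ L p.1))

/-- If a finite-dimensional real Lie algebra `𝔤` is perfect and admits a nondegenerate
ad-invariant symmetric bilinear form, then its cotangent Lie algebra `T*𝔤` is perfect:
the brackets of `T*𝔤` span all of `T*𝔤`. -/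
theorem cotangent_perfect_of_perfect
    {L : Type*} [LieRing L] [LieAlgebra ℝ L] [Module.Finite ℝ L]
    (hperf : ⁅(⊤ : LieIdeal ℝ L), (⊤ : LieIdeal ℝ L)⁆ = ⊤)
    (B : LinearMap.BilinForm ℝ L)
    (hnd : B.Nondegenerate)
    (hsymm : ∀ x y : L, B x y = B y x)
    (hinv : ∀ a b c : L, B ⁅a, b⁆ c + B b ⁅a, c⁆ = 0) :
    Submodule.span ℝ
        {p : L × Module.Dual ℝ L | ∃ a b : L × Module.Dual ℝ L, cotBracket a b = p} = ⊤ := by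
  have span_bracket : Submodule.span ℝ {z : L | ∃ x y : L, ⁅x, y⁆ = z} = ⊤ := by
    have h := congrArg LieSubmodule.toSubmodule hperf
    rw [LieSubmodule.lieIdeal_oper_eq_linear_span'] at h
    simpa using h
  set P := Submodule.span ℝ
    {p : L × Module.Dual ℝ L | ∃ a b : L × Module.Dual ℝ L, cotBracket a b = p}
  have inl_mem : ⊤ ≤ P.comap (LinearMap.inl ℝ L (Module.Dual ℝ L)) := by
    rw [← span_bracket, Submodule.span_le]
    rintro _ ⟨x, y, rfl⟩
    exact Submodule.subset_span ⟨(x, 0), (y, 0), by simp [cotBracket]⟩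
  have inr_mem : ⊤ ≤ P.comap (LinearMap.inr ℝ L (Module.Dual ℝ L) ∘ₗ B) := by
    rw [← span_bracket, Submodule.span_le]
    rintro _ ⟨x, y, rfl⟩
    refine Submodule.subset_span ⟨(x, 0), (0, B y), Prod.ext (by simp [cotBracket]) ?_⟩
    ext c
    simpa [cotBracket] using (eq_neg_of_add_eq_zero_left (hinv x y c)).symm
  rw [eq_top_iff]
  rintro ⟨x, f⟩ -
  obtain ⟨z, rfl⟩ := (B.toDual hnd).surjective f
  have hz : B.toDual hnd z = B z := LinearMap.ext fun _ => LinearMap.BilinForm.toDual_def hnd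
  simpa [hz] using P.add_mem (inl_mem (Submodule.mem_top (x := x)))
    (inr_mem (Submodule.mem_top (x := z)))
end

section
/- Let 𝔤 be a finite-dimensional simple real Lie algebra and let μ be an ad-invariant symmetric bilinear form on the cotangent Lie algebra T*𝔤. Then the subspace {0} × 𝔤* is totally isotropic for μ: μ((0,f),(0,g)) = 0 for all f,g ∈ 𝔤*. -/
/-- For a centerless finite-dimensional Lie algebra, a subspace of the dual that contains all
coadjoint translates `f ∘ ad y` is everything. -/
theorem eq_top_of_forall_comp_ad_mem {K L : Type*} [Field K] [LieRing L] [LieAlgebra K L]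
    [Module.Finite K L] (hL : LieAlgebra.center K L = ⊥) (W : Submodule K (Module.Dual K L))
    (hW : ∀ (f : Module.Dual K L) (y : L), f ∘ₗ LieAlgebra.ad K L y ∈ W) : W = ⊤ := by
  have hbot : W.dualCoannihilator = ⊥ := by
    rw [Submodule.eq_bot_iff]
    intro x hx
    rw [Submodule.mem_dualCoannihilator] at hx
    have hmem : x ∈ LieAlgebra.center K L := by
      rw [LieModule.mem_maxTrivSubmodule]
      intro y
      exact (Module.forall_dual_apply_eq_zero_iff K _).mp fun f => hx _ (hW f y)
    simpa [hL] using hmem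
  rw [← Subspace.dualCoannihilator_dualAnnihilator_eq (W := W), hbot,
    Submodule.dualAnnihilator_bot]

/-- For a finite-dimensional simple real Lie algebra `𝔤`, the subspace `{0} × 𝔤*` is
totally isotropic for every ad-invariant symmetric bilinear form on the cotangent
Lie algebra `T*𝔤`. -/
theorem dual_totallyIsotropic_of_adInvariant
    {L : Type*} [LieRing L] [LieAlgebra ℝ L] [Module.Finite ℝ L]
    [LieAlgebra.IsSimple ℝ L]
    (μ : LinearMap.BilinForm ℝ (L × Module.Dual ℝ L))
    (hsymm : ∀ p q : L × Module.Dual ℝ L, μ p q = μ q p)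
    (hinv : ∀ p q r : L × Module.Dual ℝ L,
      μ (cotBracket p q) r + μ q (cotBracket p r) = 0) :
    ∀ f g : Module.Dual ℝ L, μ (0, f) (0, g) = 0 := by
  intro f g
  have htop := eq_top_of_forall_comp_ad_mem (LieAlgebra.center_eq_bot ℝ L)
    (LinearMap.ker (μ.flip (0, g) ∘ₗ LinearMap.inr ℝ L (Module.Dual ℝ L))) fun f y => by
      simpa [cotBracket, Prod.mk_zero_zero] using hinv (0, f) (y, 0) (0, g)
  exact LinearMap.congr_fun (LinearMap.ker_eq_top.mp htop) f
end

section
/- Let 𝔤 be a finite-dimensional simple real Lie algebra of odd dimension, with Killing form κ. Then every ad-invariant symmetric bilinear form μ on the cotangent Lie algebra T*𝔤 has the form μ((x,f),(y,g)) = s·κ(x,y) + t·(f(y) + g(x)) for some constants s,t ∈ ℝ; moreover such a form μ is nondegenerate if and only if t ≠ 0. -/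
open LieAlgebra Module

/-- An odd-degree monic real polynomial has a real root. -/
theorem Polynomial.exists_isRoot_of_monic_of_odd_natDegree {p : Polynomial ℝ} (hp : p.Monic)
    (hodd : Odd p.natDegree) : ∃ c : ℝ, p.IsRoot c := by
  have hpos (q : Polynomial ℝ) (hq : 0 < q.natDegree) (hl : q.leadingCoeff = 1) :
      ∃ a, 0 ≤ q.eval a :=
    ((q.tendsto_atTop_of_leadingCoeff_nonneg (Polynomial.natDegree_pos_iff_degree_pos.mp hq)
      (hl ▸ zero_le_one)).eventually_ge_atTop 0).exists
  obtain ⟨a, ha⟩ := hpos p hodd.pos hp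
  obtain ⟨b, hb⟩ := hpos (-p.comp (-Polynomial.X))
    (by simpa [Polynomial.natDegree_comp] using hodd.pos)
    (by simp [Polynomial.leadingCoeff_comp, hp.leadingCoeff, hodd.neg_one_pow])
  have hb' : p.eval (-b) ≤ 0 := by simpa using hb
  exact mem_range_of_exists_le_of_exists_ge p.continuous ⟨-b, hb'⟩ ⟨a, ha⟩

/-- On an odd-dimensional simple real Lie algebra, every endomorphism commuting with the adjoint
action is a scalar. -/
theorem LieAlgebra.IsSimple.exists_eq_smul_of_odd_finrank {L : Type*} [LieRing L] [LieAlgebra ℝ L]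
    [Module.Finite ℝ L] [IsSimple ℝ L] (hodd : Odd (finrank ℝ L)) (φ : End ℝ L)
    (hφ : ∀ w x : L, φ ⁅w, x⁆ = ⁅w, φ x⁆) : ∃ c : ℝ, ∀ x, φ x = c • x := by
  obtain ⟨c, hc⟩ := Polynomial.exists_isRoot_of_monic_of_odd_natDegree φ.charpoly_monic
    (by rwa [φ.charpoly_natDegree])
  rw [← Module.End.hasEigenvalue_iff_isRoot_charpoly] at hc
  obtain ⟨v, hv⟩ := hc.exists_hasEigenvector
  let I : LieIdeal ℝ L :=
    { φ.eigenspace c with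
      lie_mem := by
        intro w x hx
        have hx' : φ x = c • x := Module.End.mem_eigenspace_iff.mp hx
        exact Module.End.mem_eigenspace_iff.mpr (by rw [hφ, hx', lie_smul]) }
  have hvI : v ∈ I := hv.1
  have hI : I = ⊤ := (IsSimple.eq_bot_or_eq_top (R := ℝ) I).resolve_left fun h ↦
    hv.2 (by rwa [h, LieSubmodule.mem_bot] at hvI)
  refine ⟨c, fun x ↦ ?_⟩
  have hx : x ∈ I := hI ▸ LieSubmodule.mem_top x
  exact Module.End.mem_eigenspace_iff.mp hx

/-- On a Lie algebra with non-degenerate Killing form, every linear form is represented by the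
Killing form. -/
theorem LieAlgebra.IsKilling.exists_killingForm_eq {K L : Type*} [Field K] [LieRing L]
    [LieAlgebra K L] [Module.Finite K L] [IsKilling K L] (f : Dual K L) :
    ∃ z : L, killingForm K L z = f :=
  ((killingForm K L).toDual (IsKilling.killingForm_nondegenerate K L)).surjective f

/-- On an odd-dimensional simple real Lie algebra, every invariant bilinear form is a multiple of
the Killing form. -/
theorem LieAlgebra.IsSimple.exists_eq_smul_killingForm_of_odd_finrank {L : Type*} [LieRing L]
    [LieAlgebra ℝ L] [Module.Finite ℝ L] [IsSimple ℝ L] (hodd : Odd (finrank ℝ L))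
    (B : LinearMap.BilinForm ℝ L) (hB : ∀ w x y : L, B ⁅w, x⁆ y + B x ⁅w, y⁆ = 0) :
    ∃ c : ℝ, B = c • killingForm ℝ L := by
  let e := (killingForm ℝ L).toDual (IsKilling.killingForm_nondegenerate ℝ L)
  have he (x y : L) : killingForm ℝ L (e.symm (B x)) y = B x y :=
    LinearMap.BilinForm.apply_toDual_symm_apply ..
  obtain ⟨c, hc⟩ := exists_eq_smul_of_odd_finrank hodd (e.symm.toLinearMap ∘ₗ B) fun w x ↦ by
    apply e.injective
    ext y
    change killingForm ℝ L (e.symm (B ⁅w, x⁆)) y = killingForm ℝ L ⁅w, e.symm (B x)⁆ y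
    rw [he, LieModule.traceForm_apply_lie_apply', he]
    linarith [hB w x y]
  refine ⟨c, LinearMap.ext₂ fun x y ↦ ?_⟩
  have hx : e.symm (B x) = c • x := hc x
  rw [← he, hx]
  simp

/-- On the cotangent Lie algebra of an odd-dimensional simple real Lie algebra, every
ad-invariant symmetric bilinear form is `μ((x,f),(y,g)) = s·κ(x,y) + t·(f(y)+g(x))`
for some reals `s, t`, and such a form is nondegenerate iff `t ≠ 0`. -/
theorem adInvariant_form_on_cotangent_odd_dim
    {L : Type*} [LieRing L] [LieAlgebra ℝ L] [Module.Finite ℝ L]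
    [LieAlgebra.IsSimple ℝ L]
    (hodd : Odd (Module.finrank ℝ L))
    (μ : LinearMap.BilinForm ℝ (L × Module.Dual ℝ L))
    (hsymm : ∀ p q : L × Module.Dual ℝ L, μ p q = μ q p)
    (hinv : ∀ p q r : L × Module.Dual ℝ L,
      μ (cotBracket p q) r + μ q (cotBracket p r) = 0) :
    ∃ s t : ℝ,
      (∀ (x y : L) (f g : Module.Dual ℝ L),
        μ (x, f) (y, g) = s * killingForm ℝ L x y + t * (f y + g x)) ∧
      (μ.Nondegenerate ↔ t ≠ 0) := by
  have hκ (w z : L) : -(killingForm ℝ L z ∘ₗ ad ℝ L w) = killingForm ℝ L ⁅w, z⁆ := by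
    ext y
    simp [LieModule.traceForm_apply_lie_apply']
  let i := LinearMap.inl ℝ L (Dual ℝ L)
  let j := LinearMap.inr ℝ L (Dual ℝ L) ∘ₗ killingForm ℝ L
  have hii (w x : L) : cotBracket (i w) (i x) = i ⁅w, x⁆ := by
    simp [cotBracket, i]
  have hij (w z : L) : cotBracket (i w) (j z) = j ⁅w, z⁆ := by
    simp [cotBracket, i, j, hκ]
  have hji (z w : L) : cotBracket (j z) (i w) = j ⁅z, w⁆ := by
    rw [← lie_skew, map_neg, ← hij]
    simp [cotBracket, i, j]
  have hjj (z w : L) : cotBracket (j z) (j w) = 0 := by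
    simp [cotBracket, j]
  obtain ⟨s, hs⟩ := IsSimple.exists_eq_smul_killingForm_of_odd_finrank hodd (μ.compl₁₂ i i)
    fun w x y ↦ by simpa [hii] using hinv (i w) (i x) (i y)
  obtain ⟨t, ht⟩ := IsSimple.exists_eq_smul_killingForm_of_odd_finrank hodd (μ.compl₁₂ i j)
    fun w x y ↦ by simpa [hii, hij] using hinv (i w) (i x) (j y)
  have hμii (x y : L) : μ (i x) (i y) = s * killingForm ℝ L x y := LinearMap.congr_fun₂ hs x y
  have hμij (x y : L) : μ (i x) (j y) = t * killingForm ℝ L x y := LinearMap.congr_fun₂ ht x y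
  have hμjj (z w : L) : μ (j z) (j w) = 0 := by
    obtain ⟨c, hc⟩ := IsSimple.exists_eq_smul_killingForm_of_odd_finrank hodd (μ.compl₁₂ j j)
      fun w x y ↦ by simpa [hij] using hinv (i w) (j x) (j y)
    have hann (x y w : L) : μ (j ⁅x, y⁆) (j w) = 0 := by
      simpa [hji, hjj] using hinv (j x) (i y) (j w)
    have hbr : ∃ x y : L, ⁅x, y⁆ ≠ 0 := by
      by_contra! h
      exact IsSimple.non_abelian ℝ (L := L) ⟨h⟩
    obtain ⟨x, y, hxy⟩ := hbr
    have hc0 : c = 0 := by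
      by_contra hc0
      refine hxy ((IsKilling.killingForm_nondegenerate ℝ L).1 _ fun u ↦ ?_)
      have hu : μ (j ⁅x, y⁆) (j u) = c * killingForm ℝ L ⁅x, y⁆ u := LinearMap.congr_fun₂ hc _ _
      exact (mul_eq_zero.mp (hu.symm.trans (hann x y u))).resolve_left hc0
    have hzw : μ (j z) (j w) = c * killingForm ℝ L z w := LinearMap.congr_fun₂ hc z w
    rw [hzw, hc0, zero_mul]
  have hform (x y : L) (f g : Dual ℝ L) :
      μ (x, f) (y, g) = s * killingForm ℝ L x y + t * (f y + g x) := by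
    obtain ⟨z, rfl⟩ := IsKilling.exists_killingForm_eq f
    obtain ⟨w, rfl⟩ := IsKilling.exists_killingForm_eq g
    have hx (x z : L) : (x, killingForm ℝ L z) = i x + j z := by simp [i, j]
    rw [hx, hx, map_add, map_add, LinearMap.add_apply, LinearMap.add_apply, hμii, hμij, hμjj,
      hsymm (j z), hμij, LieModule.traceForm_comm ℝ L L w x, LieModule.traceForm_comm ℝ L L z y]
    ring
  have : Nontrivial L := nontrivial_of_finrank_pos hodd.pos
  refine ⟨s, t, hform, ?_, fun ht0 ↦ ?_⟩
  · rintro ⟨hl, -⟩ rfl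
    obtain ⟨f, hf⟩ := exists_ne (0 : Dual ℝ L)
    refine hf (Prod.mk_eq_zero.mp (hl (0, f) ?_)).2
    rintro ⟨y, g⟩
    simp [hform]
  · have hrefl : μ.IsRefl := fun p q h ↦ by rw [hsymm, h]
    refine hrefl.nondegenerate_iff_separatingLeft.mpr ?_
    rintro ⟨x, f⟩ h
    have hx : x = 0 := by
      refine (Module.forall_dual_apply_eq_zero_iff ℝ x).mp fun g ↦ ?_
      simpa [hform, ht0] using h (0, g)
    subst hx
    have hf : f = 0 := by
      ext y
      simpa [hform, ht0] using h (y, 0)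
    rw [hf, Prod.mk_zero_zero]
end

section
/- Let 𝔤 be a finite-dimensional simple real Lie algebra with dim 𝔤 = n, and let μ be a nondegenerate ad-invariant symmetric bilinear form on the cotangent Lie algebra T*𝔤 (a 2n-dimensional real vector space). Then μ has signature (n,n): there exist subspaces P and N of T*𝔤 with dim P = dim N = n, μ positive definite on P, μ negative definite on N, and T*𝔤 = P ⊕ N. -/
open Module

/-- A linear functional on the dual of a centerless Lie algebra that kills every `f ∘ ad x`
is zero. -/
lemma dual_dual_eq_zero_of_comp_ad {L : Type*} [LieRing L] [LieAlgebra ℝ L] [Module.Finite ℝ L]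
    (hc : LieAlgebra.center ℝ L = ⊥) (φ : Dual ℝ (Dual ℝ L))
    (h : ∀ (f : Dual ℝ L) (x : L), φ (f ∘ₗ LieAlgebra.ad ℝ L x) = 0) : φ = 0 := by
  obtain ⟨z, rfl⟩ := (evalEquiv ℝ L).surjective φ
  have hz : z ∈ LieAlgebra.center ℝ L := by
    rw [LieModule.mem_maxTrivSubmodule]
    intro x
    rw [← forall_dual_apply_eq_zero_iff ℝ]
    intro f
    simpa using h f x
  rw [hc, LieSubmodule.mem_bot] at hz
  rw [hz, map_zero]

/-- The ideal `0 × 𝔤*` of the cotangent algebra of a centerless Lie algebra is totally isotropic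
for every ad-invariant bilinear form. -/
lemma adInvariant_inr_inr_eq_zero {L : Type*} [LieRing L] [LieAlgebra ℝ L] [Module.Finite ℝ L]
    (hc : LieAlgebra.center ℝ L = ⊥)
    (μ : LinearMap.BilinForm ℝ (L × Dual ℝ L))
    (hinv : ∀ p q r : L × Dual ℝ L, μ (cotBracket p q) r + μ q (cotBracket p r) = 0)
    (f g : Dual ℝ L) : μ (0, f) (0, g) = 0 := by
  have key := dual_dual_eq_zero_of_comp_ad hc (μ.flip (0, g) ∘ₗ LinearMap.inr ℝ L (Dual ℝ L))
    fun f x ↦ by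
      have hfg : cotBracket ((0, f) : L × Dual ℝ L) (0, g) = 0 := by
        ext <;> simp [cotBracket]
      have h := hinv (0, f) (x, 0) (0, g)
      rw [hfg, map_zero, add_zero] at h
      simpa [cotBracket] using h
  simpa using LinearMap.congr_fun key f

/-- Every finite-dimensional real vector space carries a positive definite bilinear form. -/
lemma exists_bilinForm_pos (V : Type*) [AddCommGroup V] [Module ℝ V] [Module.Finite ℝ V] :
    ∃ E : LinearMap.BilinForm ℝ V, ∀ x, x ≠ 0 → 0 < E x x := by
  let b := Module.finBasis ℝ V
  refine ⟨∑ i, (LinearMap.mul ℝ ℝ).compl₁₂ (b.coord i) (b.coord i), fun x hx ↦ ?_⟩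
  obtain ⟨i, hi⟩ : ∃ i, b.coord i x ≠ 0 := by
    by_contra! h
    exact hx (b.forall_coord_eq_zero_iff.mp h)
  simp only [LinearMap.sum_apply, LinearMap.compl₁₂_apply, LinearMap.mul_apply']
  exact Finset.sum_pos' (fun j _ ↦ mul_self_nonneg _)
    ⟨i, Finset.mem_univ i, mul_self_pos.mpr hi⟩

/-- If `0 × V*` is totally isotropic for a nondegenerate symmetric form on `V × V*`, then every
bilinear form on `V` is the pullback, on the diagonal, of that form along a section of the
first projection. -/
lemma exists_section_apply_self {V : Type*} [AddCommGroup V] [Module ℝ V] [Module.Finite ℝ V]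
    (μ : LinearMap.BilinForm ℝ (V × Dual ℝ V)) (hnd : μ.Nondegenerate)
    (hsymm : ∀ p q, μ p q = μ q p) (hiso : ∀ f g : Dual ℝ V, μ (0, f) (0, g) = 0)
    (E : LinearMap.BilinForm ℝ V) :
    ∃ T : V →ₗ[ℝ] V × Dual ℝ V, (∀ x, (T x).1 = x) ∧ ∀ x, μ (T x) (T x) = E x x := by
  let B : Dual ℝ V →ₗ[ℝ] Dual ℝ V :=
    μ.compl₁₂ (LinearMap.inr ℝ V (Dual ℝ V)) (LinearMap.inl ℝ V (Dual ℝ V))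
  have hB : Function.Injective B := by
    rw [injective_iff_map_eq_zero]
    intro f hf
    have h0 : ((0, f) : V × Dual ℝ V) = 0 := hnd.1 _ fun q ↦ by
      have h1 : μ (0, f) (q.1, 0) = 0 := LinearMap.congr_fun hf q.1
      have h2 : q = (q.1, 0) + (0, q.2) := by simp
      rw [h2, map_add, h1, hiso, add_zero]
    simpa using h0
  let e := LinearEquiv.ofInjectiveEndo B hB
  let Q : LinearMap.BilinForm ℝ V :=
    μ.compl₁₂ (LinearMap.inl ℝ V (Dual ℝ V)) (LinearMap.inl ℝ V (Dual ℝ V))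
  let C : V →ₗ[ℝ] Dual ℝ V := e.symm.toLinearMap ∘ₗ ((1 / 2 : ℝ) • (E - Q))
  refine ⟨LinearMap.id.prod C, fun x ↦ rfl, fun x ↦ ?_⟩
  have hC : μ (0, C x) (x, 0) = 1 / 2 * (E x x - μ (x, 0) (x, 0)) :=
    LinearMap.congr_fun (e.apply_symm_apply (((1 / 2 : ℝ) • (E - Q)) x)) x
  have hT : LinearMap.id.prod C x = (x, 0) + (0, C x) := by simp
  rw [hT, map_add, map_add, LinearMap.add_apply, LinearMap.add_apply, hiso,
    hsymm (x, 0) (0, C x), hC]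
  ring

/-- Every nondegenerate ad-invariant symmetric bilinear form on the cotangent Lie algebra
of an `n`-dimensional simple real Lie algebra has signature `(n, n)`. -/
theorem adInvariant_form_on_cotangent_signature
    {L : Type*} [LieRing L] [LieAlgebra ℝ L] [Module.Finite ℝ L]
    [LieAlgebra.IsSimple ℝ L]
    (μ : LinearMap.BilinForm ℝ (L × Module.Dual ℝ L))
    (hnd : μ.Nondegenerate)
    (hsymm : ∀ p q : L × Module.Dual ℝ L, μ p q = μ q p)
    (hinv : ∀ p q r : L × Module.Dual ℝ L,
      μ (cotBracket p q) r + μ q (cotBracket p r) = 0) :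
    ∃ P N : Submodule ℝ (L × Module.Dual ℝ L),
      Module.finrank ℝ P = Module.finrank ℝ L ∧
      Module.finrank ℝ N = Module.finrank ℝ L ∧
      (∀ p ∈ P, p ≠ 0 → 0 < μ p p) ∧
      (∀ p ∈ N, p ≠ 0 → μ p p < 0) ∧
      IsCompl P N := by
  obtain ⟨E, hE⟩ := exists_bilinForm_pos L
  have hiso := adInvariant_inr_inr_eq_zero
    (LieAlgebra.center_eq_bot ℝ L) μ hinv
  obtain ⟨S, hS, hSE⟩ := exists_section_apply_self μ hnd hsymm hiso E
  obtain ⟨T, hT, hTE⟩ := exists_section_apply_self μ hnd hsymm hiso (-E)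
  have hSr : finrank ℝ (LinearMap.range S) = finrank ℝ L :=
    LinearMap.finrank_range_of_inj (Function.LeftInverse.injective hS)
  have hTr : finrank ℝ (LinearMap.range T) = finrank ℝ L :=
    LinearMap.finrank_range_of_inj (Function.LeftInverse.injective hT)
  have hpos : ∀ p ∈ LinearMap.range S, p ≠ 0 → 0 < μ p p := by
    rintro _ ⟨x, rfl⟩ hx
    rw [hSE]
    exact hE x fun h ↦ hx (by rw [h, map_zero])
  have hneg : ∀ p ∈ LinearMap.range T, p ≠ 0 → μ p p < 0 := by
    rintro _ ⟨x, rfl⟩ hx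
    rw [hTE, LinearMap.neg_apply, LinearMap.neg_apply, neg_lt_zero]
    exact hE x fun h ↦ hx (by rw [h, map_zero])
  have hdisj : Disjoint (LinearMap.range S) (LinearMap.range T) := by
    rw [Submodule.disjoint_def]
    intro p hp hp'
    by_contra h
    exact lt_asymm (hpos p hp h) (hneg p hp' h)
  refine ⟨LinearMap.range S, LinearMap.range T, hSr, hTr, hpos, hneg, hdisj, ?_⟩
  rw [codisjoint_iff]
  refine Submodule.eq_top_of_disjoint _ _ ?_ hdisj
  rw [hSr, hTr, Module.finrank_prod, Subspace.dual_finrank_eq]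
end

section
/- Let 𝔰𝔬(3,1) be the real Lie algebra of the Lorentz group, realized as the space of real 4×4 matrices X satisfying Xᵀη + ηX = 0, where η = diag(1,1,1,−1), with the commutator bracket. Then the real vector space of ad-invariant symmetric bilinear forms on 𝔰𝔬(3,1) has dimension exactly 2. -/
open Matrix

/-- The Minkowski form `η = diag(1,1,1,−1)`. -/
def lorentzEta : Matrix (Fin 4) (Fin 4) ℝ := Matrix.diagonal ![1, 1, 1, -1]

/-- The Lorentz Lie algebra `𝔰𝔬(3,1)`: real `4×4` matrices `X` with `Xᵀη + ηX = 0`. -/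
def so31 : Submodule ℝ (Matrix (Fin 4) (Fin 4) ℝ) :=
  skewAdjointMatricesSubmodule lorentzEta

/-- The commutator bracket on `𝔰𝔬(3,1)`. -/
def so31Brk (a b : so31) : so31 :=
  ⟨a.1 * b.1 - b.1 * a.1, by
    have ha : a.1ᵀ * lorentzEta = lorentzEta * (-a.1) :=
      (mem_skewAdjointMatricesSubmodule lorentzEta a.1).mp a.2
    have hb : b.1ᵀ * lorentzEta = lorentzEta * (-b.1) :=
      (mem_skewAdjointMatricesSubmodule lorentzEta b.1).mp b.2
    refine (mem_skewAdjointMatricesSubmodule lorentzEta _).mpr ?_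
    show (a.1 * b.1 - b.1 * a.1)ᵀ * lorentzEta = lorentzEta * -(a.1 * b.1 - b.1 * a.1)
    have h1 : (a.1 * b.1 - b.1 * a.1)ᵀ = b.1ᵀ * a.1ᵀ - a.1ᵀ * b.1ᵀ := by
      simp [Matrix.transpose_sub, Matrix.transpose_mul]
    rw [h1, Matrix.sub_mul, Matrix.mul_assoc, Matrix.mul_assoc, ha, hb]
    rw [Matrix.mul_neg, Matrix.mul_neg, ← Matrix.mul_assoc, ← Matrix.mul_assoc, ha, hb]
    simp only [Matrix.neg_mul, Matrix.mul_neg, neg_neg, Matrix.mul_sub, Matrix.mul_assoc]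
    abel⟩

/-- The space of ad-invariant symmetric bilinear forms on `𝔰𝔬(3,1)`. -/
noncomputable def adInvSymForms : Submodule ℝ (↥so31 →ₗ[ℝ] ↥so31 →ₗ[ℝ] ℝ) where
  carrier :=
    {B | (∀ x y, B x y = B y x) ∧ ∀ a b c, B (so31Brk a b) c + B b (so31Brk a c) = 0}
  add_mem' := by
    rintro B C ⟨hB1, hB2⟩ ⟨hC1, hC2⟩
    refine ⟨fun x y => ?_, fun a b c => ?_⟩
    · simp [hB1 x y, hC1 x y]
    · have h1 := hB2 a b c
      have h2 := hC2 a b c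
      simp only [LinearMap.add_apply]
      linarith
  zero_mem' := ⟨fun x y => rfl, fun a b c => by simp⟩
  smul_mem' := by
    rintro t B ⟨h1, h2⟩
    refine ⟨fun x y => ?_, fun a b c => ?_⟩
    · simp [h1 x y]
    · simp only [LinearMap.smul_apply, smul_eq_mul]
      rw [← mul_add, h2 a b c, mul_zero]

theorem mem_so31_iff (X : Matrix (Fin 4) (Fin 4) ℝ) :
    X ∈ so31 ↔ Xᵀ * lorentzEta + lorentzEta * X = 0 := by
  rw [so31, mem_skewAdjointMatricesSubmodule, Matrix.IsSkewAdjoint, Matrix.IsAdjointPair,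
    Matrix.mul_neg, eq_neg_iff_add_eq_zero]

theorem so31_apply_swap (X : so31) (i j : Fin 4) :
    X.1 j i * ![1, 1, 1, -1] j + ![1, 1, 1, -1] i * X.1 i j = 0 := by
  have h := congrFun₂ ((mem_so31_iff X.1).mp X.2) i j
  rwa [lorentzEta, Matrix.add_apply, Matrix.mul_diagonal, Matrix.diagonal_mul] at h

/-- Coordinates on `𝔰𝔬(3,1)`: the rotation vector and the boost vector. -/
def so31Equiv : so31 ≃ₗ[ℝ] (Fin 3 → ℝ) × (Fin 3 → ℝ) where
  toFun X := (![X.1 2 1, X.1 0 2, X.1 1 0], ![X.1 0 3, X.1 1 3, X.1 2 3])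
  map_add' X Y := by ext i <;> fin_cases i <;> rfl
  map_smul' t X := by ext i <;> fin_cases i <;> rfl
  invFun p := ⟨!![0, -p.1 2, p.1 1, p.2 0; p.1 2, 0, -p.1 0, p.2 1;
      -p.1 1, p.1 0, 0, p.2 2; p.2 0, p.2 1, p.2 2, 0], by
    rw [mem_so31_iff]
    ext i j
    rw [lorentzEta, Matrix.add_apply, Matrix.mul_diagonal, Matrix.diagonal_mul]
    fin_cases i <;> fin_cases j <;> simp⟩
  left_inv X := by
    ext i j
    have h := so31_apply_swap X i j
    have hd := so31_apply_swap X i i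
    fin_cases i <;> fin_cases j <;> simp at h hd ⊢ <;> linarith
  right_inv p := by ext i <;> fin_cases i <;> rfl

theorem so31Equiv_brk (a b : so31) :
    so31Equiv (so31Brk a b) =
      ((so31Equiv a).1 ⨯₃ (so31Equiv b).1 - (so31Equiv a).2 ⨯₃ (so31Equiv b).2,
        (so31Equiv a).1 ⨯₃ (so31Equiv b).2 + (so31Equiv a).2 ⨯₃ (so31Equiv b).1) := by
  obtain ⟨p, rfl⟩ := so31Equiv.symm.surjective a
  obtain ⟨q, rfl⟩ := so31Equiv.symm.surjective b
  simp only [LinearEquiv.apply_symm_apply, cross_apply]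
  ext i <;> fin_cases i <;>
    simp [so31Equiv, so31Brk] <;> ring

/-- The invariant form on `𝔰𝔬(3,1)` with coefficients `α` and `β`. -/
def so31Form (α β : ℝ) : so31 →ₗ[ℝ] so31 →ₗ[ℝ] ℝ :=
  LinearMap.mk₂ ℝ (fun a b =>
    α * ((so31Equiv a).1 ⬝ᵥ (so31Equiv b).1 - (so31Equiv a).2 ⬝ᵥ (so31Equiv b).2) +
    β * ((so31Equiv a).1 ⬝ᵥ (so31Equiv b).2 + (so31Equiv a).2 ⬝ᵥ (so31Equiv b).1))
    (fun a a' b => by simp only [map_add, Prod.fst_add, Prod.snd_add, add_dotProduct]; ring)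
    (fun t a b => by
      simp only [map_smul, Prod.smul_fst, Prod.smul_snd, smul_dotProduct, smul_eq_mul]; ring)
    (fun a b b' => by simp only [map_add, Prod.fst_add, Prod.snd_add, dotProduct_add]; ring)
    (fun t a b => by
      simp only [map_smul, Prod.smul_fst, Prod.smul_snd, dotProduct_smul, smul_eq_mul]; ring)

theorem so31Form_apply (α β : ℝ) (a b : so31) : so31Form α β a b =
    α * ((so31Equiv a).1 ⬝ᵥ (so31Equiv b).1 - (so31Equiv a).2 ⬝ᵥ (so31Equiv b).2) +
    β * ((so31Equiv a).1 ⬝ᵥ (so31Equiv b).2 + (so31Equiv a).2 ⬝ᵥ (so31Equiv b).1) := rfl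

theorem so31Form_mem (α β : ℝ) : so31Form α β ∈ adInvSymForms := by
  refine ⟨fun a b => ?_, fun a b c => ?_⟩
  · simp only [so31Form_apply, vec3_dotProduct]
    ring
  · simp only [so31Form_apply, so31Equiv_brk, cross_apply, vec3_dotProduct, Pi.add_apply,
      Pi.sub_apply, cons_val]
    ring

/-- A bilinear form on `ℝ³` invariant under infinitesimal rotations is a multiple of the dot
product. -/
theorem eq_mul_dotProduct_of_cross_invariant (b : (Fin 3 → ℝ) →ₗ[ℝ] (Fin 3 → ℝ) →ₗ[ℝ] ℝ)
    (h : ∀ u v w, b (u ⨯₃ v) w + b v (u ⨯₃ w) = 0) (v w : Fin 3 → ℝ) :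
    b v w = b ![1, 0, 0] ![1, 0, 0] * (v ⬝ᵥ w) := by
  have key (x : Fin 3 → ℝ) :
      x = x 0 • ![1, 0, 0] + x 1 • ![0, 1, 0] + x 2 • ![0, 0, 1] := by
    ext i; fin_cases i <;> simp
  have c01 : (![1, 0, 0] : Fin 3 → ℝ) ⨯₃ ![0, 1, 0] = ![0, 0, 1] := by simp [cross_apply]
  have c12 : (![0, 1, 0] : Fin 3 → ℝ) ⨯₃ ![0, 0, 1] = ![1, 0, 0] := by simp [cross_apply]
  have c20 : (![0, 0, 1] : Fin 3 → ℝ) ⨯₃ ![1, 0, 0] = ![0, 1, 0] := by simp [cross_apply]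
  have c10 := (cross_anticomm (![1, 0, 0] : Fin 3 → ℝ) ![0, 1, 0]).symm
  have c21 := (cross_anticomm (![0, 1, 0] : Fin 3 → ℝ) ![0, 0, 1]).symm
  have c02 := (cross_anticomm (![0, 0, 1] : Fin 3 → ℝ) ![1, 0, 0]).symm
  have h01 := h ![0, 1, 0] ![0, 0, 1] ![0, 1, 0]
  have h02 := h ![0, 0, 1] ![0, 1, 0] ![0, 0, 1]
  have h10 := h ![1, 0, 0] ![0, 0, 1] ![1, 0, 0]
  have h12 := h ![0, 0, 1] ![1, 0, 0] ![0, 0, 1]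
  have h20 := h ![1, 0, 0] ![0, 1, 0] ![1, 0, 0]
  have h21 := h ![0, 1, 0] ![1, 0, 0] ![0, 1, 0]
  have h11 := h ![0, 0, 1] ![1, 0, 0] ![0, 1, 0]
  have h22 := h ![0, 1, 0] ![1, 0, 0] ![0, 0, 1]
  simp only [c01, c12, c20, c10, c21, c02, cross_self, map_neg, map_zero, LinearMap.neg_apply,
    add_zero, neg_eq_zero] at h01 h02 h10 h12 h20 h21 h11 h22
  conv_lhs => rw [key v, key w]
  simp only [map_add, map_smul, LinearMap.add_apply, LinearMap.smul_apply, smul_eq_mul,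
    h01, h02, h10, h12, h20, h21, vec3_dotProduct]
  linear_combination (v 1 * w 1) * h11 - (v 2 * w 2) * h22

theorem so31_brk_symm (p q : (Fin 3 → ℝ) × (Fin 3 → ℝ)) :
    so31Brk (so31Equiv.symm p) (so31Equiv.symm q) =
      so31Equiv.symm (p.1 ⨯₃ q.1 - p.2 ⨯₃ q.2, p.1 ⨯₃ q.2 + p.2 ⨯₃ q.1) := by
  rw [LinearEquiv.eq_symm_apply, so31Equiv_brk]
  simp only [LinearEquiv.apply_symm_apply]

/-- The infinitesimal rotation with a given rotation vector. -/
def so31Rot : (Fin 3 → ℝ) →ₗ[ℝ] so31 := so31Equiv.symm.toLinearMap ∘ₗ LinearMap.inl ℝ _ _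

/-- The infinitesimal boost with a given boost vector. -/
def so31Boost : (Fin 3 → ℝ) →ₗ[ℝ] so31 := so31Equiv.symm.toLinearMap ∘ₗ LinearMap.inr ℝ _ _

theorem so31Brk_rot_rot (v w : Fin 3 → ℝ) :
    so31Brk (so31Rot v) (so31Rot w) = so31Rot (v ⨯₃ w) := by
  simp [so31Rot, so31_brk_symm]

theorem so31Brk_rot_boost (v w : Fin 3 → ℝ) :
    so31Brk (so31Rot v) (so31Boost w) = so31Boost (v ⨯₃ w) := by
  simp [so31Rot, so31Boost, so31_brk_symm]

theorem so31Brk_boost_rot (v w : Fin 3 → ℝ) :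
    so31Brk (so31Boost v) (so31Rot w) = so31Boost (v ⨯₃ w) := by
  simp [so31Rot, so31Boost, so31_brk_symm]

theorem so31Brk_boost_boost (v w : Fin 3 → ℝ) :
    so31Brk (so31Boost v) (so31Boost w) = -so31Rot (v ⨯₃ w) := by
  rw [← map_neg]
  simp [so31Rot, so31Boost, so31_brk_symm]

theorem so31_eq_rot_add_boost (a : so31) :
    a = so31Rot (so31Equiv a).1 + so31Boost (so31Equiv a).2 := by
  apply so31Equiv.injective
  simp [so31Rot, so31Boost]

theorem eq_so31Form_of_mem {B : so31 →ₗ[ℝ] so31 →ₗ[ℝ] ℝ} (hB : B ∈ adInvSymForms) :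
    B = so31Form (B (so31Rot ![1, 0, 0]) (so31Rot ![1, 0, 0]))
      (B (so31Rot ![1, 0, 0]) (so31Boost ![1, 0, 0])) := by
  obtain ⟨hsymm, hinv⟩ := hB
  have hRR := eq_mul_dotProduct_of_cross_invariant (B.compl₁₂ so31Rot so31Rot) fun u v w => by
    simpa [so31Brk_rot_rot] using hinv (so31Rot u) (so31Rot v) (so31Rot w)
  have hRK := eq_mul_dotProduct_of_cross_invariant (B.compl₁₂ so31Rot so31Boost) fun u v w => by
    simpa [so31Brk_rot_rot, so31Brk_rot_boost] using
      hinv (so31Rot u) (so31Rot v) (so31Boost w)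
  have hKK := eq_mul_dotProduct_of_cross_invariant (B.compl₁₂ so31Boost so31Boost)
    fun u v w => by
      simpa [so31Brk_rot_boost] using hinv (so31Rot u) (so31Boost v) (so31Boost w)
  simp only [LinearMap.compl₁₂_apply] at hRR hRK hKK
  have hneg := hinv (so31Boost ![0, 1, 0]) (so31Rot ![0, 0, 1]) (so31Boost ![1, 0, 0])
  rw [so31Brk_boost_rot, so31Brk_boost_boost, map_neg, hRR, hKK] at hneg
  simp [cross_apply] at hneg
  ext a b : 2
  rw [so31Form_apply]
  conv_lhs => rw [so31_eq_rot_add_boost a, so31_eq_rot_add_boost b]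
  simp only [map_add, LinearMap.add_apply]
  rw [hsymm (so31Boost _) (so31Rot _), hRR, hRK, hRK (so31Equiv a).1, hKK,
    dotProduct_comm (so31Equiv b).1]
  linear_combination ((so31Equiv a).2 ⬝ᵥ (so31Equiv b).2) * hneg

/-- Invariant symmetric forms on `𝔰𝔬(3,1)` correspond to pairs of real coefficients. -/
noncomputable def adInvSymFormsEquiv : adInvSymForms ≃ₗ[ℝ] ℝ × ℝ where
  toFun B := (B.1 (so31Rot ![1, 0, 0]) (so31Rot ![1, 0, 0]),
    B.1 (so31Rot ![1, 0, 0]) (so31Boost ![1, 0, 0]))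
  map_add' _ _ := rfl
  map_smul' _ _ := rfl
  invFun c := ⟨so31Form c.1 c.2, so31Form_mem c.1 c.2⟩
  left_inv B := Subtype.ext (eq_so31Form_of_mem B.2).symm
  right_inv c := by simp [so31Form_apply, so31Rot, so31Boost]

/-- The Lie algebra `𝔰𝔬(3,1)` consists exactly of the matrices `X` with `Xᵀη + ηX = 0`,
and its space of ad-invariant symmetric bilinear forms has dimension exactly `2`. -/
theorem finrank_adInvSymForms_so31_eq_two :
    (∀ X : Matrix (Fin 4) (Fin 4) ℝ,
      X ∈ so31 ↔ Xᵀ * lorentzEta + lorentzEta * X = 0) ∧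
    Module.finrank ℝ adInvSymForms = 2 :=
  ⟨mem_so31_iff, by rw [adInvSymFormsEquiv.finrank_eq]; simp⟩
end

section
/- Let 𝕊 = ℍ[ℝ,−1,1] be the algebra of split quaternions, generated over ℝ by i, j, k with i² = −1, j² = k² = 1, i j = k, j i = −k, with conjugation Q* = q₀ − q_x i − q_y j − q_z k for Q = q₀ + q_x i + q_y j + q_z k. Let 𝕊₁ = {Q ∈ 𝕊 : Q Q* = 1} be the group of unit split quaternions and Im 𝕊 = {u ∈ 𝕊 : re(u) = 0} the additive group of pure split quaternions, on which 𝕊₁ acts by u ↦ Q u Q* (this action preserves Im 𝕊). Let the dual split quaternions be the pairs (P₀,P₁) with P_i ∈ 𝕊 and product (P₀,P₁)(Q₀,Q₁) = (P₀Q₀, P₀Q₁ + P₁Q₀), with conjugation C(P₀,P₁) = (P₀*, P₁*). Then the set of unit dual split quaternions Ŝ = {P : P·C(P) = 1} is a subgroup of the group of invertible dual split quaternions, and the map (Q,u) ↦ (Q, u Q) is a group isomorphism from the semidirect product 𝕊₁ ⋉ Im 𝕊 onto Ŝ. -/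
open Quaternion TrivSqZeroExt

/-- The split quaternions `𝕊 = ℍ[ℝ,−1,1]` (with `i² = −1`, `j² = k² = 1`, `ij = k = −ji`). -/
abbrev SplitQuat : Type := ℍ[ℝ, -1, 1]

/-- The group of unit split quaternions `𝕊₁ = {Q : Q Q* = 1}`. -/
def unitSplitQuat : Set SplitQuat := {Q | Q * star Q = 1}

/-- The pure (imaginary) split quaternions. -/
def pureSplitQuat : Set SplitQuat := {u | u.re = 0}

/-- Conjugation on dual split quaternions: `C(P₀ + ε P₁) = P₀* + ε P₁*`. -/
noncomputable def dualSplitQuatConj (P : DualNumber SplitQuat) : DualNumber SplitQuat :=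
  inl (star P.fst) + (TrivSqZeroExt.inr (star P.snd) : DualNumber SplitQuat)

/-- The set of unit dual split quaternions. -/
noncomputable def unitDualSplitQuat : Set (DualNumber SplitQuat) :=
  {P | P * dualSplitQuatConj P = 1}

/-- The product of the semidirect product `𝕊₁ ⋉ Im 𝕊`, where `𝕊₁` acts on `Im 𝕊` by
`u ↦ Q u Q*`. -/
def mulSdSplitQuat (p q : SplitQuat × SplitQuat) : SplitQuat × SplitQuat :=
  (p.1 * q.1, p.2 + p.1 * q.2 * star p.1)

/-- The map `(Q, u) ↦ Q + ε (u Q)` from `𝕊₁ ⋉ Im 𝕊` to the dual split quaternions. -/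
noncomputable def toDualSplitQuat (p : SplitQuat × SplitQuat) : DualNumber SplitQuat :=
  inl p.1 + (TrivSqZeroExt.inr (p.2 * p.1) : DualNumber SplitQuat)

theorem mem_unitSplitQuat {q : SplitQuat} : q ∈ unitSplitQuat ↔ q * star q = 1 := Iff.rfl

theorem star_mul_self_of_mem_unitSplitQuat {q : SplitQuat} (hq : q ∈ unitSplitQuat) :
    star q * q = 1 := by
  rw [← mem_unitSplitQuat.1 hq]
  ext <;> simp <;> ring

theorem mem_pureSplitQuat {u : SplitQuat} : u ∈ pureSplitQuat ↔ star u = -u := by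
  constructor
  · intro h
    have h : u.re = 0 := h
    ext <;> simp [h]
  · intro h
    have h := congrArg QuaternionAlgebra.re h
    simp at h
    change u.re = 0
    linarith

theorem conj_mem_pureSplitQuat (q : SplitQuat) {u : SplitQuat} (hu : u ∈ pureSplitQuat) :
    q * u * star q ∈ pureSplitQuat := by
  rw [mem_pureSplitQuat] at hu ⊢
  simp only [star_mul, star_star, hu, mul_neg, neg_mul, mul_assoc]

@[simp]
theorem fst_dualSplitQuatConj (P : DualNumber SplitQuat) :
    (dualSplitQuatConj P).fst = star P.fst := by
  simp [dualSplitQuatConj]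

@[simp]
theorem snd_dualSplitQuatConj (P : DualNumber SplitQuat) :
    (dualSplitQuatConj P).snd = star P.snd := by
  simp [dualSplitQuatConj]

@[simp]
theorem fst_toDualSplitQuat (p : SplitQuat × SplitQuat) : (toDualSplitQuat p).fst = p.1 := by
  simp [toDualSplitQuat]

@[simp]
theorem snd_toDualSplitQuat (p : SplitQuat × SplitQuat) :
    (toDualSplitQuat p).snd = p.2 * p.1 := by
  simp [toDualSplitQuat]

theorem dualSplitQuatConj_mul (P Q : DualNumber SplitQuat) :
    dualSplitQuatConj (P * Q) = dualSplitQuatConj Q * dualSplitQuatConj P := by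
  apply TrivSqZeroExt.ext
  · simp
  · simp [add_comm]

theorem dualSplitQuatConj_dualSplitQuatConj (P : DualNumber SplitQuat) :
    dualSplitQuatConj (dualSplitQuatConj P) = P := by
  apply TrivSqZeroExt.ext <;> simp

theorem mem_unitDualSplitQuat {P : DualNumber SplitQuat} :
    P ∈ unitDualSplitQuat ↔
      P.fst ∈ unitSplitQuat ∧ P.fst * star P.snd + P.snd * star P.fst = 0 := by
  change P * dualSplitQuatConj P = 1 ↔ _
  simp [TrivSqZeroExt.ext_iff, mem_unitSplitQuat]

theorem mem_unitDualSplitQuat_iff_pure {P : DualNumber SplitQuat} :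
    P ∈ unitDualSplitQuat ↔ P.fst ∈ unitSplitQuat ∧ P.snd * star P.fst ∈ pureSplitQuat := by
  rw [mem_unitDualSplitQuat, mem_pureSplitQuat, star_mul, star_star, eq_neg_iff_add_eq_zero]

theorem dualSplitQuatConj_mul_self {P : DualNumber SplitQuat} (hP : P ∈ unitDualSplitQuat) :
    dualSplitQuatConj P * P = 1 := by
  obtain ⟨h₀, h₁⟩ := mem_unitDualSplitQuat.1 hP
  have h₂ := star_mul_self_of_mem_unitSplitQuat h₀
  apply TrivSqZeroExt.ext
  · simpa using h₂
  · have h₃ : star P.fst * (P.fst * star P.snd + P.snd * star P.fst) * P.fst =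
        star P.fst * P.fst * (star P.snd * P.fst) +
          star P.fst * P.snd * (star P.fst * P.fst) := by noncomm_ring
    rw [h₁, h₂, mul_zero, zero_mul, one_mul, mul_one] at h₃
    simpa [add_comm] using h₃.symm

theorem toDualSplitQuat_bijOn :
    Set.BijOn toDualSplitQuat (unitSplitQuat ×ˢ pureSplitQuat) unitDualSplitQuat := by
  refine ⟨?_, ?_, ?_⟩
  · rintro ⟨q, u⟩ ⟨hq, hu⟩
    refine mem_unitDualSplitQuat_iff_pure.2 ⟨by simpa using hq, ?_⟩
    simpa [mul_assoc, mem_unitSplitQuat.1 hq] using hu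
  · rintro ⟨q, u⟩ ⟨hq, -⟩ ⟨r, v⟩ - h
    have h₁ : q = r := by simpa using congrArg TrivSqZeroExt.fst h
    subst h₁
    have h₂ : u * q = v * q := by simpa using congrArg TrivSqZeroExt.snd h
    have h₃ := congrArg (· * star q) h₂
    simp only [mul_assoc, mem_unitSplitQuat.1 hq, mul_one] at h₃
    rw [h₃]
  · intro P hP
    obtain ⟨h₀, h₁⟩ := mem_unitDualSplitQuat_iff_pure.1 hP
    refine ⟨(P.fst, P.snd * star P.fst), ⟨h₀, h₁⟩, ?_⟩
    apply TrivSqZeroExt.ext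
    · simp
    · simp [mul_assoc, star_mul_self_of_mem_unitSplitQuat h₀]

theorem toDualSplitQuat_mul {p : SplitQuat × SplitQuat} (hp : p.1 ∈ unitSplitQuat)
    (q : SplitQuat × SplitQuat) :
    toDualSplitQuat (mulSdSplitQuat p q) = toDualSplitQuat p * toDualSplitQuat q := by
  apply TrivSqZeroExt.ext
  · simp [mulSdSplitQuat]
  · have h : p.1 * q.2 * star p.1 * (p.1 * q.1) = p.1 * (q.2 * q.1) := by
      rw [mul_assoc, ← mul_assoc (star p.1), star_mul_self_of_mem_unitSplitQuat hp, one_mul,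
        mul_assoc]
    simp only [mulSdSplitQuat, snd_toDualSplitQuat, fst_toDualSplitQuat, snd_mul, smul_eq_mul,
      MulOpposite.smul_eq_mul_unop, MulOpposite.unop_op, add_mul, h]
    rw [add_comm, mul_assoc]

/-- The unit dual split quaternions form a subgroup of the invertible dual split
quaternions, and `(Q, u) ↦ Q + ε (u Q)` is a group isomorphism from `𝕊₁ ⋉ Im 𝕊`
onto them. -/
theorem unitDualSplitQuat_group_iso :
    (∀ q ∈ unitSplitQuat, ∀ u ∈ pureSplitQuat, q * u * star q ∈ pureSplitQuat) ∧
    ((1 : DualNumber SplitQuat) ∈ unitDualSplitQuat ∧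
      (∀ P ∈ unitDualSplitQuat, ∀ Q ∈ unitDualSplitQuat, P * Q ∈ unitDualSplitQuat) ∧
      (∀ P ∈ unitDualSplitQuat, IsUnit P ∧
        ∃ Q ∈ unitDualSplitQuat, P * Q = 1 ∧ Q * P = 1)) ∧
    Set.BijOn toDualSplitQuat (unitSplitQuat ×ˢ pureSplitQuat) unitDualSplitQuat ∧
    (∀ p q : SplitQuat × SplitQuat,
      p ∈ unitSplitQuat ×ˢ pureSplitQuat → q ∈ unitSplitQuat ×ˢ pureSplitQuat →
      toDualSplitQuat (mulSdSplitQuat p q) = toDualSplitQuat p * toDualSplitQuat q) := by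
  refine ⟨fun q _ u hu => conj_mem_pureSplitQuat q hu, ⟨?_, ?_, ?_⟩, toDualSplitQuat_bijOn,
    fun p q hp _ => toDualSplitQuat_mul hp.1 q⟩
  · simp [mem_unitDualSplitQuat, mem_unitSplitQuat]
  · intro P hP Q hQ
    have hP : P * dualSplitQuatConj P = 1 := hP
    have hQ : Q * dualSplitQuatConj Q = 1 := hQ
    change P * Q * dualSplitQuatConj (P * Q) = 1
    rw [dualSplitQuatConj_mul, mul_assoc, ← mul_assoc Q, hQ, one_mul, hP]
  · intro P hP
    have h₁ : P * dualSplitQuatConj P = 1 := hP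
    have h₂ := dualSplitQuatConj_mul_self hP
    refine ⟨⟨⟨P, dualSplitQuatConj P, h₁, h₂⟩, rfl⟩, dualSplitQuatConj P, ?_, h₁, h₂⟩
    change dualSplitQuatConj P * dualSplitQuatConj (dualSplitQuatConj P) = 1
    rw [dualSplitQuatConj_dualSplitQuatConj, h₂]
end
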